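/- The following identities hold: (1) for every m≥3, k_m = k_{m-3} + t_{m-4} = (t_{m-3}+t_{m-5}+1)/2; (2) for every m≥0, ∑_{i=0}^{m} t_i = (t_m+t_{m+2}−3)/2; (3) for every m≥1, ∑_{i=1}^{m} k_i = (t_{m-2}+t_{m-3}+m)/2. -/

import Mathlib

/-- The three-letter alphabet of the Tribonacci word. -/
inductive TLetter : Type
  | a | b | c
deriving DecidableEq

/-- The Tribonacci substitution σ(a)=ab, σ(b)=ac, σ(c)=a. -/
def tsubst : TLetter → List TLetter
  | .a => [.a, .b]
  | .b => [.a, .c]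
  | .c => [.a]

/-- `Tword m = σ^m(a)`, the m-th finite Tribonacci word. -/
def Tword : ℕ → List TLetter
  | 0 => [.a]
  | n + 1 => (Tword n).flatMap tsubst

/-- The prefix 𝕋[1,n] of the Tribonacci word of length n
(each `Tword n` is a prefix of the next and has length ≥ n). -/
def TPrefix (n : ℕ) : List TLetter := (Tword n).take n

/-- A word is a factor of the Tribonacci word 𝕋. -/
def IsFactorT (w : List TLetter) : Prop := ∃ m, w <:+: Tword m

/-- `tribAux i = t_{i-2}`: Tribonacci numbers, shifted so that the index is a natural. -/
def tribAux : ℕ → ℕ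
  | 0 => 0
  | 1 => 1
  | 2 => 1
  | n + 3 => tribAux (n + 2) + tribAux (n + 1) + tribAux n

/-- The Tribonacci numbers `t m` for `m : ℤ`: t₋₂=0, t₋₁=1, t₀=1,
`t m = t (m-1) + t (m-2) + t (m-3)` for m ≥ 1. (Junk value 0 below -2.) -/
def t (m : ℤ) : ℕ := tribAux (m + 2).toNat

/-- Kernel numbers: k₀=0, k₁=k₂=1, `k m = k (m-1) + k (m-2) + k (m-3) - 1` for m ≥ 3. -/
def kAux : ℕ → ℕ
  | 0 => 0
  | 1 => 1
  | 2 => 1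
  | n + 3 => kAux (n + 2) + kAux (n + 1) + kAux n - 1

def kker (m : ℤ) : ℕ := kAux m.toNat

/-- `A n`: the number of distinct nonempty words w with ww a factor of 𝕋[1,n]. -/
noncomputable def A (n : ℕ) : ℕ := Nat.card {w : List TLetter // w ≠ [] ∧ (w ++ w) <:+: TPrefix n}

/-- `B n`: the number of occurrences of squares in 𝕋[1,n], i.e. of pairs (w,i) with
w nonempty, i ≥ 1, ww occurring in 𝕋 at position i and i + 2|w| - 1 ≤ n. -/
noncomputable def B (n : ℕ) : ℕ :=
  Nat.card {p : List TLetter × ℕ // p.1 ≠ [] ∧ 1 ≤ p.2 ∧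
    p.2 + 2 * p.1.length - 1 ≤ n ∧ (p.1 ++ p.1) <+: (TPrefix n).drop (p.2 - 1)}

/-- `C n`: the number of distinct nonempty words w with www a factor of 𝕋[1,n]. -/
noncomputable def C (n : ℕ) : ℕ := Nat.card {w : List TLetter // w ≠ [] ∧ (w ++ w ++ w) <:+: TPrefix n}

/-- `D n`: the number of occurrences of cubes in 𝕋[1,n], i.e. of pairs (w,i) with
w nonempty, i ≥ 1, www occurring in 𝕋 at position i and i + 3|w| - 1 ≤ n. -/
noncomputable def D (n : ℕ) : ℕ :=
  Nat.card {p : List TLetter × ℕ // p.1 ≠ [] ∧ 1 ≤ p.2 ∧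
    p.2 + 3 * p.1.length - 1 ≤ n ∧ (p.1 ++ p.1 ++ p.1) <+: (TPrefix n).drop (p.2 - 1)}

theorem tribAux_add_three (n : ℕ) :
    tribAux (n + 3) = tribAux (n + 2) + tribAux (n + 1) + tribAux n := rfl

theorem kAux_add_three (n : ℕ) :
    kAux (n + 3) = kAux (n + 2) + kAux (n + 1) + kAux n - 1 := rfl

theorem two_mul_kAux_add_three (n : ℕ) :
    2 * kAux (n + 3) = tribAux (n + 2) + tribAux n + 1 := by
  induction n using Nat.strong_induction_on with
  | _ n ih =>
    match n with
    | 0 | 1 | 2 => decide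
    | n + 3 =>
      have h₀ := ih n (by omega)
      have h₁ := ih (n + 1) (by omega)
      have h₂ := ih (n + 2) (by omega)
      have := kAux_add_three (n + 3)
      have := tribAux_add_three n
      have := tribAux_add_three (n + 1)
      have := tribAux_add_three (n + 2)
      simp only [add_assoc, Nat.reduceAdd] at *
      omega

theorem kAux_add_three_eq_add_tribAux (n : ℕ) :
    kAux (n + 3) = kAux n + tribAux (n + 1) := by
  match n with
  | 0 | 1 | 2 => decide
  | n + 3 =>
    have h₀ := two_mul_kAux_add_three n
    have h₁ := two_mul_kAux_add_three (n + 3)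
    have := tribAux_add_three n
    have := tribAux_add_three (n + 1)
    have := tribAux_add_three (n + 2)
    simp only [add_assoc, Nat.reduceAdd] at *
    omega

theorem t_natCast_sub (n j : ℕ) : t ((n : ℤ) - j) = tribAux (n + 2 - j) := by
  unfold t
  congr 1
  omega

theorem t_natCast_add (n j : ℕ) : t ((n : ℤ) + j) = tribAux (n + j + 2) := by
  unfold t
  congr 1

theorem kker_natCast (n : ℕ) : kker n = kAux n := rfl

theorem sum_Icc_intCast_succ {a : ℤ} {n : ℕ} (h : a ≤ n + 1) (f : ℤ → ℚ) :
    ∑ i ∈ Finset.Icc a ((n : ℤ) + 1), f i = ∑ i ∈ Finset.Icc a (n : ℤ), f i + f (n + 1) := by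
  have : Finset.Icc a ((n : ℤ) + 1) = insert ((n : ℤ) + 1) (Finset.Icc a (n : ℤ)) := by
    ext x
    simp only [Finset.mem_Icc, Finset.mem_insert]
    omega
  rw [this, Finset.sum_insert (by simp), add_comm]

theorem sum_Icc_t (n : ℕ) :
    ∑ i ∈ Finset.Icc (0 : ℤ) n, (t i : ℚ) =
      ((tribAux (n + 2) : ℚ) + tribAux (n + 4) - 3) / 2 := by
  induction n with
  | zero => simp [t, tribAux]; norm_num
  | succ n ih =>
    push_cast
    rw [sum_Icc_intCast_succ (by omega), ih, show t ((n : ℤ) + 1) = tribAux (n + 3) from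
      t_natCast_add n 1, show n + 1 + 4 = n + 2 + 3 by rfl, tribAux_add_three (n + 2)]
    push_cast
    ring

theorem sum_Icc_kker (n : ℕ) :
    ∑ i ∈ Finset.Icc (1 : ℤ) ((n + 1 : ℕ) : ℤ), (kker i : ℚ) =
      ((tribAux (n + 1) : ℚ) + tribAux n + (n + 1)) / 2 := by
  induction n with
  | zero => simp [kker, kAux, tribAux]
  | succ n ih =>
    rw [Nat.cast_succ (n + 1), sum_Icc_intCast_succ (by omega), ih,
      show kker (((n + 1 : ℕ) : ℤ) + 1) = kAux (n + 2) from rfl]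
    match n with
    | 0 => norm_num [kAux, tribAux]
    | n + 1 =>
      have h : (2 * kAux (n + 3) : ℚ) = tribAux (n + 2) + tribAux n + 1 := by
        exact_mod_cast two_mul_kAux_add_three n
      rw [show n + 1 + 1 + 1 = n + 3 by rfl, tribAux_add_three n]
      push_cast
      linarith

theorem tribonacci_kernel_identities :
    (∀ m : ℤ, 3 ≤ m →
      kker m = kker (m - 3) + t (m - 4) ∧
      (kker m : ℚ) = ((t (m - 3) : ℚ) + (t (m - 5) : ℚ) + 1) / 2) ∧
    (∀ m : ℤ, 0 ≤ m →
      (∑ i ∈ Finset.Icc (0 : ℤ) m, (t i : ℚ)) = ((t m : ℚ) + (t (m + 2) : ℚ) - 3) / 2) ∧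
    (∀ m : ℤ, 1 ≤ m →
      (∑ i ∈ Finset.Icc (1 : ℤ) m, (kker i : ℚ)) =
        ((t (m - 2) : ℚ) + (t (m - 3) : ℚ) + (m : ℚ)) / 2) := by
  refine ⟨fun m hm => ?_, fun m hm => ?_, fun m hm => ?_⟩
  · obtain ⟨n, rfl⟩ : ∃ n : ℕ, m = ((n + 3 : ℕ) : ℤ) := ⟨(m - 3).toNat, by omega⟩
    have h₃ : t (((n + 3 : ℕ) : ℤ) - 3) = tribAux (n + 2) := t_natCast_sub (n + 3) 3
    have h₄ : t (((n + 3 : ℕ) : ℤ) - 4) = tribAux (n + 1) := t_natCast_sub (n + 3) 4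
    have h₅ : t (((n + 3 : ℕ) : ℤ) - 5) = tribAux n := t_natCast_sub (n + 3) 5
    have hk : kker (((n + 3 : ℕ) : ℤ) - 3) = kAux n := by
      rw [show ((n + 3 : ℕ) : ℤ) - 3 = n by omega, kker_natCast]
    rw [h₃, h₄, h₅, hk, kker_natCast]
    refine ⟨kAux_add_three_eq_add_tribAux n, ?_⟩
    rw [eq_div_iff two_ne_zero, mul_comm]
    exact_mod_cast two_mul_kAux_add_three n
  · lift m to ℕ using hm
    exact sum_Icc_t m
  · obtain ⟨n, rfl⟩ : ∃ n : ℕ, m = ((n + 1 : ℕ) : ℤ) := ⟨(m - 1).toNat, by omega⟩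
    have h₂ : t (((n + 1 : ℕ) : ℤ) - 2) = tribAux (n + 1) := t_natCast_sub (n + 1) 2
    have h₃ : t (((n + 1 : ℕ) : ℤ) - 3) = tribAux n := t_natCast_sub (n + 1) 3
    rw [sum_Icc_kker, h₂, h₃]
    push_cast
    rfl
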